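/- arXiv:2308.12947 — 6 statements merged into one kernel-verified Lean document; each statement's English description precedes it below -/
import Mathlib

section
/- For every natural number ℓ ≥ 1 and every pair of neighboring datasets D and D' (i.e., D' is obtained from D by removing exactly one entry), the bounded distinct counts satisfy |D_ℓ(D) − D_ℓ(D')| ≤ ℓ. -/
/-- The set of distinct elements of a dataset `D = (u_1, …, u_n)`. -/
def dsUnion {Ω : Type*} [DecidableEq Ω] (D : List (Finset Ω)) : Finset Ω :=
  D.foldr (· ∪ ·) ∅

/-- The distinct count `DC(D) = |⋃ᵢ uᵢ|`. -/
def DC {Ω : Type*} [DecidableEq Ω] (D : List (Finset Ω)) : ℕ :=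
  (dsUnion D).card

/-- The bounded distinct count
`D_ℓ(D) = max { |⋃ᵢ vᵢ| : vᵢ ⊆ uᵢ and |vᵢ| ≤ ℓ for all i }`. -/
noncomputable def boundedDC {Ω : Type*} [DecidableEq Ω] (D : List (Finset Ω)) (ℓ : ℕ) : ℕ :=
  sSup { k : ℕ | ∃ v : List (Finset Ω),
    List.Forall₂ (fun a b => a ⊆ b ∧ a.card ≤ ℓ) v D ∧ k = DC v }

theorem mem_dsUnion {Ω : Type*} [DecidableEq Ω] {D : List (Finset Ω)} {x : Ω} :
    x ∈ dsUnion D ↔ ∃ u ∈ D, x ∈ u := by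
  induction D with
  | nil => simp [dsUnion]
  | cons u D ih =>
    have h : dsUnion (u :: D) = u ∪ dsUnion D := rfl
    simp [h, ih]

theorem dsUnion_subset_of_forall₂ {Ω : Type*} [DecidableEq Ω] {v D : List (Finset Ω)}
    (h : List.Forall₂ (· ⊆ ·) v D) : dsUnion v ⊆ dsUnion D := by
  induction h with
  | nil => exact subset_rfl
  | cons hab _ ih => exact Finset.union_subset_union hab ih

theorem bddAbove_boundedDC {Ω : Type*} [DecidableEq Ω] (D : List (Finset Ω)) (ℓ : ℕ) :
    BddAbove { k : ℕ | ∃ v : List (Finset Ω),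
      List.Forall₂ (fun a b => a ⊆ b ∧ a.card ≤ ℓ) v D ∧ k = DC v } := by
  refine ⟨DC D, ?_⟩
  rintro k ⟨v, hv, rfl⟩
  exact Finset.card_le_card (dsUnion_subset_of_forall₂ (hv.imp fun _ _ h => h.1))

theorem DC_le_boundedDC {Ω : Type*} [DecidableEq Ω] {v D : List (Finset Ω)} {ℓ : ℕ}
    (hv : List.Forall₂ (fun a b => a ⊆ b ∧ a.card ≤ ℓ) v D) : DC v ≤ boundedDC D ℓ :=
  le_csSup (bddAbove_boundedDC D ℓ) ⟨v, hv, rfl⟩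

theorem exists_DC_eq_boundedDC {Ω : Type*} [DecidableEq Ω] (D : List (Finset Ω)) (ℓ : ℕ) :
    ∃ v : List (Finset Ω),
      List.Forall₂ (fun a b => a ⊆ b ∧ a.card ≤ ℓ) v D ∧ boundedDC D ℓ = DC v := by
  refine Nat.sSup_mem ?_ (bddAbove_boundedDC D ℓ)
  refine ⟨_, D.map fun _ => ∅, ?_, rfl⟩
  rw [List.forall₂_map_left_iff, List.forall₂_same]
  simp

theorem boundedDC_append_le {Ω : Type*} [DecidableEq Ω] (A B : List (Finset Ω)) (u : Finset Ω)
    (ℓ : ℕ) : boundedDC (A ++ B) ℓ ≤ boundedDC (A ++ u :: B) ℓ := by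
  obtain ⟨v, hv, h⟩ := exists_DC_eq_boundedDC (A ++ B) ℓ
  have hA := List.forall₂_take_append v A B hv
  have hB := List.forall₂_drop_append v A B hv
  rw [h]
  refine le_trans (Finset.card_le_card ?_)
    (DC_le_boundedDC (List.rel_append hA (List.Forall₂.cons (a := ∅) (by simp) hB)))
  intro x hx
  rw [← List.take_append_drop A.length v] at hx
  simp only [mem_dsUnion, List.mem_append, List.mem_cons] at hx ⊢
  grind

theorem boundedDC_append_cons_le {Ω : Type*} [DecidableEq Ω] (A B : List (Finset Ω))
    (u : Finset Ω) (ℓ : ℕ) :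
    boundedDC (A ++ u :: B) ℓ ≤ boundedDC (A ++ B) ℓ + ℓ := by
  obtain ⟨v, hv, h⟩ := exists_DC_eq_boundedDC (A ++ u :: B) ℓ
  have hA := List.forall₂_take_append v A (u :: B) hv
  have hB := List.forall₂_drop_append v A (u :: B) hv
  obtain ⟨w, t, hw, ht, hd⟩ := List.forall₂_cons_right_iff.1 hB
  have hDC := DC_le_boundedDC (List.rel_append hA ht)
  have hsub : dsUnion v ⊆ dsUnion (v.take A.length ++ t) ∪ w := by
    intro x hx
    rw [← List.take_append_drop A.length v, hd] at hx
    simp only [mem_dsUnion, List.mem_append, List.mem_cons, Finset.mem_union] at hx ⊢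
    grind
  calc boundedDC (A ++ u :: B) ℓ = (dsUnion v).card := h
    _ ≤ (dsUnion (v.take A.length ++ t)).card + w.card :=
      (Finset.card_le_card hsub).trans (Finset.card_union_le _ _)
    _ ≤ boundedDC (A ++ B) ℓ + ℓ := Nat.add_le_add hDC hw.2

/-- Sensitivity of the bounded distinct count: for neighboring datasets `D`, `D'`
(`D'` is `D` with one entry removed), `|D_ℓ(D) − D_ℓ(D')| ≤ ℓ`. -/
theorem boundedDC_sensitivity {Ω : Type*} [DecidableEq Ω]
    (ℓ : ℕ) (hℓ : 1 ≤ ℓ) (D D' : List (Finset Ω))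
    (hneighbor : ∃ j, j < D.length ∧ D' = D.eraseIdx j) :
    |(boundedDC D ℓ : ℤ) - (boundedDC D' ℓ : ℤ)| ≤ (ℓ : ℤ) := by
  obtain ⟨j, hj, rfl⟩ := hneighbor
  have hD : D = D.take j ++ D[j] :: D.drop (j + 1) := by simp
  have h₁ := boundedDC_append_le (D.take j) (D.drop (j + 1)) D[j] ℓ
  have h₂ := boundedDC_append_cons_le (D.take j) (D.drop (j + 1)) D[j] ℓ
  rw [← hD, ← List.eraseIdx_eq_take_drop_succ] at h₁ h₂
  rw [abs_le]
  omega
end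

section
/- For every dataset D = (u_1, …, u_n) and every natural number ℓ ≥ 1, the bounded distinct count D_ℓ(D) equals the maximum cardinality of a set M of pairs ((i,j), v) with i ∈ [n], j ∈ [ℓ], v ∈ u_i, such that the first components (i,j) of the pairs in M are pairwise distinct and the second components v of the pairs in M are pairwise distinct (i.e., D_ℓ(D) equals the maximum size of a matching in the bipartite graph whose left vertices are the ℓ copies [n] × [ℓ] of the persons, whose right vertices are the elements of ⋃_i u_i, and which joins (i,j) to v if and only if v ∈ u_i). -/
/-- `M` is a matching in the bipartite graph whose left vertices are the `ℓ` copies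
`[n] × [ℓ]` of the persons of `D`, whose right vertices are the items, and which joins
the copy `(i, j)` of person `i` to item `v` iff `v ∈ uᵢ`: every pair `((i,j), v) ∈ M`
is an edge of the graph, the left endpoints of the pairs in `M` are pairwise distinct,
and the right endpoints of the pairs in `M` are pairwise distinct. -/
def IsMatching {Ω : Type*} [DecidableEq Ω] (D : List (Finset Ω)) (ℓ : ℕ)
    (M : Finset ((ℕ × ℕ) × Ω)) : Prop :=
  (∀ p ∈ M, p.1.1 < D.length ∧ p.1.2 < ℓ ∧ p.2 ∈ D.getD p.1.1 ∅) ∧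
  (∀ p ∈ M, ∀ q ∈ M, p.1 = q.1 → p = q) ∧
  (∀ p ∈ M, ∀ q ∈ M, p.2 = q.2 → p = q)

theorem mem_dsUnion_iff {Ω : Type*} [DecidableEq Ω] {D : List (Finset Ω)} {x : Ω} :
    x ∈ dsUnion D ↔ ∃ i < D.length, x ∈ D.getD i ∅ := by
  have h : x ∈ dsUnion D ↔ ∃ s ∈ D, x ∈ s := by
    unfold dsUnion
    induction D with
    | nil => simp
    | cons a D ih => simp [ih]
  rw [h]
  constructor
  · rintro ⟨s, hs, hx⟩
    obtain ⟨i, hi, rfl⟩ := List.mem_iff_getElem.1 hs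
    exact ⟨i, hi, by rwa [List.getD_eq_getElem _ _ hi]⟩
  · rintro ⟨i, hi, hx⟩
    rw [List.getD_eq_getElem _ _ hi] at hx
    exact ⟨_, List.getElem_mem hi, hx⟩

/-- A bounded selection of items yields a matching covering exactly the selected items. -/
theorem exists_isMatching_card_eq_DC {Ω : Type*} [DecidableEq Ω] {D v : List (Finset Ω)} {ℓ : ℕ}
    (h : List.Forall₂ (fun a b => a ⊆ b ∧ a.card ≤ ℓ) v D) :
    ∃ M : Finset ((ℕ × ℕ) × Ω), IsMatching D ℓ M ∧ DC v = M.card := by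
  obtain ⟨hlen, hget⟩ := List.forall₂_iff_get.1 h
  have hex : ∀ x, ∃ i, x ∈ dsUnion v → i < v.length ∧ x ∈ v.getD i ∅ := fun x => by
    by_cases hx : x ∈ dsUnion v
    · obtain ⟨i, hi⟩ := mem_dsUnion_iff.1 hx
      exact ⟨i, fun _ => hi⟩
    · exact ⟨0, fun h => absurd h hx⟩
  choose owner howner using hex
  let f : Ω → (ℕ × ℕ) × Ω := fun x => ((owner x, (v.getD (owner x) ∅).toList.idxOf x), x)
  refine ⟨(dsUnion v).image f, ⟨?_, ?_, ?_⟩, ?_⟩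
  · simp only [Finset.forall_mem_image]
    intro x hx
    obtain ⟨hi, hxi⟩ := howner x hx
    obtain ⟨hsub, hcard⟩ := hget (owner x) hi (hlen ▸ hi)
    rw [List.get_eq_getElem, ← List.getD_eq_getElem _ ∅] at hsub hcard
    rw [List.get_eq_getElem, ← List.getD_eq_getElem _ ∅] at hsub
    refine ⟨hlen ▸ hi, lt_of_lt_of_le ?_ hcard, hsub hxi⟩
    rw [← Finset.length_toList]
    exact List.idxOf_lt_length_iff.2 (Finset.mem_toList.2 hxi)
  · simp only [Finset.forall_mem_image]
    intro x hx y hy hxy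
    obtain ⟨hi, hj⟩ := Prod.mk.inj hxy
    rw [hi] at hj
    have hxi := (howner x hx).2
    rw [hi] at hxi
    rw [(List.idxOf_inj (Finset.mem_toList.2 hxi)).1 hj]
  · simp only [Finset.forall_mem_image]
    intro x _ y _ hxy
    exact congrArg f hxy
  · exact (Finset.card_image_of_injective _ fun x y hxy => congrArg Prod.snd hxy).symm

/-- The items matched to the copies of each person form a bounded selection. -/
theorem IsMatching.exists_forall₂_card_eq_DC {Ω : Type*} [DecidableEq Ω] {D : List (Finset Ω)}
    {ℓ : ℕ} {M : Finset ((ℕ × ℕ) × Ω)} (hM : IsMatching D ℓ M) :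
    ∃ v : List (Finset Ω),
      List.Forall₂ (fun a b => a ⊆ b ∧ a.card ≤ ℓ) v D ∧ M.card = DC v := by
  obtain ⟨hedge, hleft, hright⟩ := hM
  let g : ℕ → Finset Ω := fun i => (M.filter fun p => p.1.1 = i).image Prod.snd
  refine ⟨(List.range D.length).map g, List.forall₂_iff_get.2 ⟨by simp, ?_⟩, ?_⟩
  · intro i _ hi
    simp only [List.get_eq_getElem, List.getElem_map, List.getElem_range]
    constructor
    · intro x hx
      obtain ⟨p, hp, rfl⟩ := Finset.mem_image.1 hx
      obtain ⟨hpM, rfl⟩ := Finset.mem_filter.1 hp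
      have := (hedge p hpM).2.2
      rwa [List.getD_eq_getElem _ _ hi] at this
    · refine Finset.card_image_le.trans ?_
      rw [← Finset.card_range ℓ]
      refine Finset.card_le_card_of_injOn (fun p => p.1.2) ?_ ?_
      · intro p hp
        exact Finset.mem_coe.2 (Finset.mem_range.2 (hedge p (Finset.mem_filter.1 hp).1).2.1)
      · intro p hp q hq hpq
        obtain ⟨hp, hpi⟩ := Finset.mem_filter.1 hp
        obtain ⟨hq, hqi⟩ := Finset.mem_filter.1 hq
        exact hleft p hp q hq (Prod.ext (hpi.trans hqi.symm) hpq)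
  · have hunion : dsUnion ((List.range D.length).map g) = M.image Prod.snd := by
      ext x
      rw [mem_dsUnion_iff]
      constructor
      · rintro ⟨i, hi, hx⟩
        rw [List.getD_eq_getElem _ _ hi, List.getElem_map] at hx
        exact Finset.image_subset_image (Finset.filter_subset _ _) hx
      · intro hx
        obtain ⟨p, hp, rfl⟩ := Finset.mem_image.1 hx
        have hi : p.1.1 < ((List.range D.length).map g).length := by simpa using (hedge p hp).1
        refine ⟨p.1.1, hi, ?_⟩
        rw [List.getD_eq_getElem _ _ hi, List.getElem_map, List.getElem_range]
        exact Finset.mem_image_of_mem _ (Finset.mem_filter.2 ⟨hp, rfl⟩)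
    rw [DC, hunion]
    exact (Finset.card_image_of_injOn fun p hp q hq => hright p hp q hq).symm

/-- The bounded distinct count `D_ℓ(D)` equals the maximum cardinality of a matching
in the bipartite graph with left vertices `[n] × [ℓ]` (the `ℓ` copies of the persons),
right vertices the items, and an edge from `(i,j)` to `v` iff `v ∈ uᵢ`. -/
theorem boundedDC_eq_max_matching {Ω : Type*} [DecidableEq Ω]
    (D : List (Finset Ω)) (ℓ : ℕ) (hℓ : 1 ≤ ℓ) :
    boundedDC D ℓ =
      sSup { k : ℕ | ∃ M : Finset ((ℕ × ℕ) × Ω), IsMatching D ℓ M ∧ k = M.card } := by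
  unfold boundedDC
  congr 1
  ext k
  constructor
  · rintro ⟨v, hv, rfl⟩
    exact exists_isMatching_card_eq_DC hv
  · rintro ⟨M, hM, rfl⟩
    exact hM.exists_forall₂_card_eq_DC
end

section
/- Let g be the one-person greedy step. If finite sets S' ⊆ S of elements of Ω satisfy S ⊆ S' ∪ {x} for some x ∈ Ω, then for every finite set u ⊆ Ω there exists y ∈ Ω such that g(u, S') ⊆ g(u, S) and g(u, S) ⊆ g(u, S') ∪ {y}. -/
/-- The one-person greedy step: `g(u, S) = S ∪ {min (u \ S)}` if `u \ S ≠ ∅`,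
and `g(u, S) = S` otherwise. -/
def gstep {Ω : Type*} [LinearOrder Ω] (u S : Finset Ω) : Finset Ω :=
  if h : (u \ S).Nonempty then insert ((u \ S).min' h) S else S

/-- One greedy pass over the dataset `D = (u_1, …, u_n)`:
`S ↦ g(u_n, g(u_{n−1}, …, g(u_1, S)…))`. -/
def greedyPass {Ω : Type*} [LinearOrder Ω] (D : List (Finset Ω)) (S : Finset Ω) :
    Finset Ω :=
  D.foldl (fun T u => gstep u T) S

/-- The greedy estimate `D̂_ℓ(D)`: the cardinality of the set obtained by applying
the greedy pass over `D` exactly `ℓ` times, starting from the empty set. -/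
def greedyEst {Ω : Type*} [LinearOrder Ω] (D : List (Finset Ω)) (ℓ : ℕ) : ℕ :=
  ((greedyPass D)^[ℓ] ∅).card

theorem gstep_of_not_nonempty {Ω : Type*} [LinearOrder Ω] {u S : Finset Ω}
    (h : ¬(u \ S).Nonempty) : gstep u S = S :=
  dif_neg h

theorem gstep_of_nonempty {Ω : Type*} [LinearOrder Ω] {u S : Finset Ω}
    (h : (u \ S).Nonempty) : gstep u S = insert ((u \ S).min' h) S :=
  dif_pos h

theorem subset_gstep {Ω : Type*} [LinearOrder Ω] (u S : Finset Ω) : S ⊆ gstep u S := by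
  unfold gstep
  split_ifs
  · exact Finset.subset_insert _ _
  · exact Finset.Subset.refl _

/-- If `S' ⊆ S` and `S ⊆ S' ∪ {x}` for some `x`, then for every `u` there is `y`
with `g(u, S') ⊆ g(u, S)` and `g(u, S) ⊆ g(u, S') ∪ {y}`. -/
theorem gstep_neighbor {Ω : Type*} [LinearOrder Ω]
    (S' S : Finset Ω) (hsub : S' ⊆ S) (x : Ω) (hx : S ⊆ insert x S')
    (u : Finset Ω) :
    ∃ y : Ω, gstep u S' ⊆ gstep u S ∧ gstep u S ⊆ insert y (gstep u S') := by
  by_cases h' : (u \ S').Nonempty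
  · have hmem := Finset.mem_sdiff.mp ((u \ S').min'_mem h')
    by_cases hm : (u \ S').min' h' ∈ S
    · have hmx : (u \ S').min' h' = x :=
        (Finset.mem_insert.mp (hx hm)).resolve_right hmem.2
      have hS : gstep u S' = S := by
        rw [gstep_of_nonempty h', hmx]
        exact (Finset.insert_subset (hmx ▸ hm) hsub).antisymm hx
      rw [hS]
      by_cases h : (u \ S).Nonempty
      · exact ⟨_, subset_gstep u S, (gstep_of_nonempty h).subset⟩
      · exact ⟨x, subset_gstep u S,
          (gstep_of_not_nonempty h).subset.trans (Finset.subset_insert _ _)⟩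
    · have hmS := Finset.mem_sdiff.mpr ⟨hmem.1, hm⟩
      have h : (u \ S).Nonempty := ⟨_, hmS⟩
      have hmin : (u \ S).min' h = (u \ S').min' h' :=
        (Finset.min'_le _ _ hmS).antisymm
          (Finset.min'_subset h (Finset.sdiff_subset_sdiff (Finset.Subset.refl u) hsub))
      rw [gstep_of_nonempty h, gstep_of_nonempty h', hmin]
      refine ⟨x, Finset.insert_subset_insert _ hsub, ?_⟩
      rw [Finset.insert_comm]
      exact Finset.insert_subset_insert _ hx
  · have h : ¬(u \ S).Nonempty := fun h =>
      h' (h.mono (Finset.sdiff_subset_sdiff (Finset.Subset.refl u) hsub))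
    rw [gstep_of_not_nonempty h, gstep_of_not_nonempty h']
    exact ⟨x, hsub, hx⟩
end

section
/- For every pair of neighboring datasets D and D' (i.e., D' is obtained from D by removing exactly one entry), the greedy estimates with contribution bound 1 satisfy |D̂_1(D) − D̂_1(D')| ≤ 1. -/
theorem gstep_eq_self {Ω : Type*} [LinearOrder Ω] {u S : Finset Ω} (h : u ⊆ S) :
    gstep u S = S := by
  simp [gstep, Finset.sdiff_eq_empty_iff_subset.mpr h]

theorem gstep_eq_insert {Ω : Type*} [LinearOrder Ω] {u S : Finset Ω} {m : Ω}
    (hm : IsLeast (u \ S : Finset Ω) m) : gstep u S = insert m S := by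
  have hne : (u \ S).Nonempty := ⟨m, hm.1⟩
  rw [gstep, dif_pos hne, (Finset.isLeast_min' _ hne).unique hm]

theorem gstep_eq_self_or_insert {Ω : Type*} [LinearOrder Ω] (u S : Finset Ω) :
    gstep u S = S ∨ ∃ a, gstep u S = insert a S := by
  unfold gstep
  split_ifs with h
  · exact .inr ⟨_, rfl⟩
  · exact .inl rfl

/-- A greedy step preserves the relation of differing by at most one extra element. -/
theorem gstep_insert {Ω : Type*} [LinearOrder Ω] (u S : Finset Ω) (a : Ω) :
    gstep u (insert a S) = gstep u S ∨ ∃ b, gstep u (insert a S) = insert b (gstep u S) := by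
  by_cases h : (u \ S).Nonempty
  · have hm := Finset.isLeast_min' _ h
    generalize (u \ S).min' h = m at hm
    rw [gstep_eq_insert hm]
    obtain rfl | hne := eq_or_ne m a
    · exact gstep_eq_self_or_insert u (insert m S)
    · have hm' : IsLeast (u \ insert a S : Finset Ω) m := by
        refine ⟨?_, fun x hx => hm.2 ?_⟩
        · have := hm.1
          simp_all
        · simp_all
      exact .inr ⟨a, by rw [gstep_eq_insert hm', Finset.insert_comm]⟩
  · have hu : u ⊆ S := Finset.sdiff_eq_empty_iff_subset.mp (Finset.not_nonempty_iff_eq_empty.mp h)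
    exact .inr ⟨a, by
      rw [gstep_eq_self hu, gstep_eq_self (hu.trans (Finset.subset_insert a S))]⟩

theorem greedyPass_insert {Ω : Type*} [LinearOrder Ω] (D : List (Finset Ω)) (S : Finset Ω)
    (a : Ω) : greedyPass D (insert a S) = greedyPass D S ∨
      ∃ b, greedyPass D (insert a S) = insert b (greedyPass D S) := by
  induction D generalizing S a with
  | nil => exact .inr ⟨a, rfl⟩
  | cons u D ih =>
    change greedyPass D (gstep u (insert a S)) = greedyPass D (gstep u S) ∨
      ∃ b, greedyPass D (gstep u (insert a S)) = insert b (greedyPass D (gstep u S))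
    obtain h | ⟨b, h⟩ := gstep_insert u S a
    · exact .inl (by rw [h])
    · rw [h]
      exact ih _ b

theorem greedyPass_eraseIdx {Ω : Type*} [LinearOrder Ω] (D : List (Finset Ω)) (j : ℕ)
    (S : Finset Ω) : greedyPass D S = greedyPass (D.eraseIdx j) S ∨
      ∃ b, greedyPass D S = insert b (greedyPass (D.eraseIdx j) S) := by
  induction D generalizing S j with
  | nil => exact .inl rfl
  | cons u D ih =>
    cases j with
    | zero =>
      change greedyPass D (gstep u S) = greedyPass D S ∨
        ∃ b, greedyPass D (gstep u S) = insert b (greedyPass D S)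
      obtain h | ⟨a, h⟩ := gstep_eq_self_or_insert u S
      · exact .inl (by rw [h])
      · rw [h]
        exact greedyPass_insert D S a
    | succ j => exact ih j (gstep u S)

/-- Sensitivity of the greedy estimate with contribution bound 1: for neighboring
datasets `D`, `D'` (`D'` is `D` with one entry removed), `|D̂₁(D) − D̂₁(D')| ≤ 1`. -/
theorem greedyEst_one_sensitivity {Ω : Type*} [LinearOrder Ω]
    (D D' : List (Finset Ω))
    (hneighbor : ∃ j, j < D.length ∧ D' = D.eraseIdx j) :
    |(greedyEst D 1 : ℤ) - (greedyEst D' 1 : ℤ)| ≤ 1 := by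
  obtain ⟨j, -, rfl⟩ := hneighbor
  simp only [greedyEst, Function.iterate_one]
  obtain h | ⟨b, h⟩ := greedyPass_eraseIdx D j ∅
  · simp [h]
  · have hle := Finset.card_insert_le b (greedyPass (D.eraseIdx j) ∅)
    have hge := Finset.card_le_card (Finset.subset_insert b (greedyPass (D.eraseIdx j) ∅))
    rw [h, abs_le]
    lia
end

section
/- For every dataset D = (u_1, …, u_n), the greedy estimate is nondecreasing in ℓ, and if max_{i∈[n]} |u_i| ≤ ℓ_* then for all natural numbers ℓ ≥ 1, D̂_ℓ(D) ≤ D̂_{ℓ_*}(D); in particular D̂_ℓ(D) = D̂_{ℓ_*}(D) for all ℓ ≥ ℓ_*. -/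
theorem card_sdiff_gstep_le {Ω : Type*} [LinearOrder Ω] (u S : Finset Ω) :
    (u \ gstep u S).card ≤ (u \ S).card - 1 := by
  unfold gstep
  split_ifs with h
  · rw [Finset.sdiff_insert, Finset.card_erase_of_mem (Finset.min'_mem _ h)]
  · simp [Finset.not_nonempty_iff_eq_empty.mp h]

theorem subset_greedyPass {Ω : Type*} [LinearOrder Ω] (D : List (Finset Ω)) (S : Finset Ω) :
    S ⊆ greedyPass D S := by
  induction D generalizing S with
  | nil => exact Finset.Subset.refl S
  | cons u D ih => exact (subset_gstep u S).trans (ih (gstep u S))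

theorem greedyPass_eq_self {Ω : Type*} [LinearOrder Ω] {D : List (Finset Ω)} {S : Finset Ω}
    (h : ∀ u ∈ D, u ⊆ S) : greedyPass D S = S := by
  induction D with
  | nil => rfl
  | cons u D ih =>
    change greedyPass D (gstep u S) = S
    rw [gstep_eq_self (h u List.mem_cons_self)]
    exact ih fun v hv => h v (List.mem_cons_of_mem u hv)

theorem card_sdiff_greedyPass_le {Ω : Type*} [LinearOrder Ω] {D : List (Finset Ω)}
    {u : Finset Ω} (hu : u ∈ D) (S : Finset Ω) :
    (u \ greedyPass D S).card ≤ (u \ S).card - 1 := by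
  induction D generalizing S with
  | nil => cases hu
  | cons v D ih =>
    change (u \ greedyPass D (gstep v S)).card ≤ _
    rcases List.mem_cons.mp hu with rfl | hu
    · exact (Finset.card_le_card (Finset.sdiff_subset_sdiff (Finset.Subset.refl u)
        (subset_greedyPass D _))).trans (card_sdiff_gstep_le u S)
    · exact (ih hu _).trans (Nat.sub_le_sub_right (Finset.card_le_card
        (Finset.sdiff_subset_sdiff (Finset.Subset.refl u) (subset_gstep v S))) 1)

theorem card_sdiff_iterate_greedyPass_le {Ω : Type*} [LinearOrder Ω] {D : List (Finset Ω)}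
    {u : Finset Ω} (hu : u ∈ D) (S : Finset Ω) (k : ℕ) :
    (u \ (greedyPass D)^[k] S).card ≤ (u \ S).card - k := by
  induction k with
  | zero => simp
  | succ k ih =>
    rw [Function.iterate_succ_apply']
    have := card_sdiff_greedyPass_le hu ((greedyPass D)^[k] S)
    omega

theorem greedyEst_mono {Ω : Type*} [LinearOrder Ω] (D : List (Finset Ω)) :
    Monotone (greedyEst D) := by
  refine monotone_nat_of_le_succ fun k => ?_
  unfold greedyEst
  rw [Function.iterate_succ_apply']
  exact Finset.card_le_card (subset_greedyPass D _)

theorem greedyEst_eq_of_card_le {Ω : Type*} [LinearOrder Ω] {D : List (Finset Ω)} {m k : ℕ}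
    (hD : ∀ u ∈ D, u.card ≤ m) (hk : m ≤ k) : greedyEst D k = greedyEst D m := by
  have hfix : greedyPass D ((greedyPass D)^[m] ∅) = (greedyPass D)^[m] ∅ := by
    refine greedyPass_eq_self fun u hu => ?_
    have hle := card_sdiff_iterate_greedyPass_le hu ∅ m
    rw [Finset.sdiff_empty, Nat.sub_eq_zero_of_le (hD u hu), Nat.le_zero,
      Finset.card_eq_zero] at hle
    exact Finset.sdiff_eq_empty_iff_subset.mp hle
  obtain ⟨j, rfl⟩ := Nat.exists_eq_add_of_le' hk
  unfold greedyEst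
  rw [Function.iterate_add_apply, Function.iterate_fixed hfix]


/-- The greedy estimate is nondecreasing in `ℓ`; moreover, if every person contributes
at most `ℓ₀` elements, then `D̂_ℓ(D) ≤ D̂_{ℓ₀}(D)` for all `ℓ ≥ 1`, and in particular
`D̂_ℓ(D) = D̂_{ℓ₀}(D)` for all `ℓ ≥ ℓ₀`. -/
theorem greedyEst_mono_and_saturates {Ω : Type*} [LinearOrder Ω]
    (D : List (Finset Ω)) :
    (∀ ℓ ℓ' : ℕ, ℓ ≤ ℓ' → greedyEst D ℓ ≤ greedyEst D ℓ') ∧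
    (∀ ℓ₀ : ℕ, (∀ u ∈ D, u.card ≤ ℓ₀) →
      (∀ ℓ : ℕ, 1 ≤ ℓ → greedyEst D ℓ ≤ greedyEst D ℓ₀) ∧
      (∀ ℓ : ℕ, ℓ₀ ≤ ℓ → greedyEst D ℓ = greedyEst D ℓ₀)) := by
  refine ⟨fun ℓ ℓ' h => greedyEst_mono D h, fun ℓ₀ hD => ⟨fun ℓ _ => ?_,
    fun ℓ hℓ => greedyEst_eq_of_card_le hD hℓ⟩⟩
  rcases le_total ℓ ℓ₀ with h | h
  · exact greedyEst_mono D h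
  · exact (greedyEst_eq_of_card_le hD h).le
end

section
/- Let m ≥ 1, let q : Fin m → ℝ, let Δ : Fin m → ℝ with Δ_j > 0 for all j, let t ∈ ℝ, and fix i ∈ Fin m. Then for every real s: s = min over j ∈ Fin m of ((q_i − t·Δ_i) − (q_j − t·Δ_j))/(Δ_i + Δ_j) if and only if q_i − (s + t)·Δ_i = max over j ∈ Fin m of (q_j + (s − t)·Δ_j). -/
/-- Characterization of the normalized scores of the generalized exponential
mechanism: `s = min_j ((q_i − t·Δ_i) − (q_j − t·Δ_j))/(Δ_i + Δ_j)` if and only if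
`q_i − (s + t)·Δ_i = max_j (q_j + (s − t)·Δ_j)`. -/
theorem gem_normalized_score_iff
    (m : ℕ) (hm : 1 ≤ m) (q Δ : Fin m → ℝ) (hΔ : ∀ j, 0 < Δ j)
    (t : ℝ) (i : Fin m) (s : ℝ) :
    s = Finset.univ.inf' ⟨i, Finset.mem_univ i⟩
          (fun j => ((q i - t * Δ i) - (q j - t * Δ j)) / (Δ i + Δ j)) ↔
      q i - (s + t) * Δ i =
        Finset.univ.sup' ⟨i, Finset.mem_univ i⟩ (fun j => q j + (s - t) * Δ j) := by
  have hpos : ∀ j, 0 < Δ i + Δ j := fun j => add_pos (hΔ i) (hΔ j)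
  have hne : (Finset.univ : Finset (Fin m)).Nonempty := ⟨i, Finset.mem_univ i⟩
  change s = Finset.univ.inf' hne _ ↔ _ = Finset.univ.sup' hne _
  rw [le_antisymm_iff, le_antisymm_iff, and_comm, Finset.le_inf'_iff, Finset.inf'_le_iff,
    Finset.sup'_le_iff, Finset.le_sup'_iff]
  refine and_congr (exists_congr fun j => and_congr_right fun _ => ?_)
    (forall₂_congr fun j _ => ?_)
  · rw [div_le_iff₀ (hpos j)]
    constructor <;> intro h <;> linarith
  · rw [le_div_iff₀ (hpos j)]
    constructor <;> intro h <;> linarith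
end
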